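/- Let ℓ > 0, Ω = (0,π)×(−ℓ,ℓ), 0 < α < β, t > 0, and let u : Ω → (0,∞) be a bounded measurable positive function. For each m ≥ 1 let φ_m : [−ℓ,ℓ]×[−ℓ,ℓ] → ℝ be continuous with 0 < φ_{m+1}(y,w) < φ_m(y,w) for all m ≥ 1 and all y, w ∈ [−ℓ,ℓ], and define the kernel K(x,y,ρ,w) := ∑_{m=1}^∞ (φ_m(y,w)/m³) sin(mρ) sin(mx). Then ∫_{Ω×Ω} K(x,y,ρ,w) · p_u(x,y) u(x,y) · p_u(ρ,w) u(ρ,w) dxdy dρdw ≤ ∫_{Ω×Ω} K(x,y,ρ,w) · p_{u_H}(x,y) u_H(x,y) · p_{u_H}(ρ,w) u_H(ρ,w) dxdy dρdw. -/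

import Mathlib

open Real MeasureTheory

/-- Polarization of a function on `ℝ × ℝ` with respect to the half-plane `x ≤ π/2`,
reflecting across the line `x = π/2` (so `x ↦ π - x`). -/
noncomputable def polarization (v : ℝ × ℝ → ℝ) : ℝ × ℝ → ℝ := fun z =>
  if z.1 ≤ π / 2 then max (v z) (v (π - z.1, z.2))
  else min (v z) (v (π - z.1, z.2))

/-- The two-valued weight associated to a function `v`: it equals `α` where
`0 < v ≤ √t` and `β` elsewhere (in particular where `v > √t`). -/
noncomputable def weight (α β t : ℝ) (v : ℝ × ℝ → ℝ) : ℝ × ℝ → ℝ := fun z =>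
  if 0 < v z ∧ v z ≤ Real.sqrt t then α else β

open Finset in
/-- Closed form of the Dirichlet-type cosine sum. -/
lemma two_sin_half_mul_sum_cos (n : ℕ) (θ : ℝ) :
    2 * sin (θ / 2) * ∑ k ∈ range n, cos (((k : ℝ) + 1) * θ) =
      sin (((n : ℝ) + 1 / 2) * θ) - sin (θ / 2) := by
  induction n with
  | zero => simp [div_eq_inv_mul]
  | succ n ih =>
    rw [sum_range_succ, mul_add, ih]
    have h1 : (((n + 1 : ℕ) : ℝ) + 1 / 2) * θ = ((n : ℝ) + 1) * θ + θ / 2 := by push_cast; ring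
    have h2 : ((n : ℝ) + 1 / 2) * θ = ((n : ℝ) + 1) * θ - θ / 2 := by ring
    rw [h1, h2, sin_add, sin_sub]
    ring

open Finset in
/-- The Fejér–Jackson inequality (non-strict form). -/
lemma sum_sin_div_nonneg (n : ℕ) :
    ∀ θ ∈ Set.Icc (0 : ℝ) π, 0 ≤ ∑ k ∈ range n, sin (((k : ℝ) + 1) * θ) / ((k : ℝ) + 1) := by
  induction n with
  | zero => simp
  | succ n ih =>
    set S : ℝ → ℝ := fun θ => ∑ k ∈ range (n + 1), sin (((k : ℝ) + 1) * θ) / ((k : ℝ) + 1) with hS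
    have hd : ∀ θ, HasDerivAt S (∑ k ∈ range (n + 1), cos (((k : ℝ) + 1) * θ)) θ := by
      intro θ
      refine HasDerivAt.fun_sum fun k _ => ?_
      have hk : (k : ℝ) + 1 ≠ 0 := by positivity
      have h := ((hasDerivAt_id θ).const_mul ((k : ℝ) + 1)).sin.div_const ((k : ℝ) + 1)
      refine h.congr_deriv ?_
      simp only [id]
      field_simp
    obtain ⟨x, hx, hmin⟩ := isCompact_Icc.exists_isMinOn (Set.nonempty_Icc.2 pi_pos.le)
      (fun θ _ => (hd θ).continuousAt.continuousWithinAt : ContinuousOn S (Set.Icc 0 π))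
    suffices h : 0 ≤ S x from fun θ hθ => h.trans (hmin hθ)
    rcases eq_or_lt_of_le hx.1 with h0 | h0
    · simp [hS, ← h0]
    rcases eq_or_lt_of_le hx.2 with h1 | h1
    · refine (sum_eq_zero fun k _ => ?_).ge
      have := sin_nat_mul_pi (k + 1)
      push_cast at this
      rw [h1, this, zero_div]
    have hzero := (hmin.isLocalMin (Icc_mem_nhds h0 h1)).hasDerivAt_eq_zero (hd x)
    have hD := two_sin_half_mul_sum_cos (n + 1) x
    rw [hzero, mul_zero] at hD
    have hs : 0 ≤ sin (x / 2) := sin_nonneg_of_nonneg_of_le_pi (by linarith) (by linarith)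
    have hc : 0 ≤ cos (x / 2) := cos_nonneg_of_mem_Icc ⟨by linarith, by linarith⟩
    have hsq : cos ((((n + 1 : ℕ) : ℝ) + 1 / 2) * x) ^ 2 = cos (x / 2) ^ 2 := by
      rw [cos_sq', cos_sq', show sin ((((n + 1 : ℕ) : ℝ) + 1 / 2) * x) = sin (x / 2) by linarith]
    have hle : cos ((((n + 1 : ℕ) : ℝ) + 1 / 2) * x) ≤ cos (x / 2) :=
      (abs_le_of_sq_le_sq' hsq.le hc).2
    have hlast : 0 ≤ sin (((n : ℝ) + 1) * x) := by
      have : ((n : ℝ) + 1) * x = (((n + 1 : ℕ) : ℝ) + 1 / 2) * x - x / 2 := by push_cast; ring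
      rw [this, sin_sub, show sin ((((n + 1 : ℕ) : ℝ) + 1 / 2) * x) = sin (x / 2) by linarith]
      nlinarith
    simp only [hS, sum_range_succ]
    exact add_nonneg (ih x hx) (by positivity)

open Finset in
lemma antitoneOn_sum_cos_div_sq (n : ℕ) :
    AntitoneOn (fun θ : ℝ => ∑ k ∈ range n, cos (((k : ℝ) + 1) * θ) / ((k : ℝ) + 1) ^ 2)
      (Set.Icc 0 π) := by
  have hd : ∀ θ : ℝ, HasDerivAt
      (fun θ : ℝ => ∑ k ∈ range n, cos (((k : ℝ) + 1) * θ) / ((k : ℝ) + 1) ^ 2)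
      (∑ k ∈ range n, -(sin (((k : ℝ) + 1) * θ) / ((k : ℝ) + 1))) θ := by
    intro θ
    refine HasDerivAt.fun_sum fun k _ => ?_
    have hk : (k : ℝ) + 1 ≠ 0 := by positivity
    have h := ((hasDerivAt_id θ).const_mul ((k : ℝ) + 1)).cos.div_const (((k : ℝ) + 1) ^ 2)
    refine h.congr_deriv ?_
    simp only [id]
    field_simp
  refine antitoneOn_of_deriv_nonpos (convex_Icc 0 π)
    (fun θ _ => (hd θ).continuousAt.continuousWithinAt)
    (fun θ _ => (hd θ).differentiableAt.differentiableWithinAt) fun θ hθ => ?_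
  rw [(hd θ).deriv, sum_neg_distrib, neg_nonpos]
  exact sum_sin_div_nonneg n θ (interior_subset hθ)

open Finset in
lemma sum_sin_mul_sin_div_sq_nonneg (n : ℕ) {a b : ℝ} (ha : a ∈ Set.Icc 0 π)
    (hb : b ∈ Set.Icc 0 π) :
    0 ≤ ∑ k ∈ range n, sin (((k : ℝ) + 1) * a) * sin (((k : ℝ) + 1) * b) / ((k : ℝ) + 1) ^ 2 := by
  set C : ℝ → ℝ := fun θ => ∑ k ∈ range n, cos (((k : ℝ) + 1) * θ) / ((k : ℝ) + 1) ^ 2 with hC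
  have hanti : AntitoneOn C (Set.Icc 0 π) := antitoneOn_sum_cos_div_sq n
  have heq : ∑ k ∈ range n, sin (((k : ℝ) + 1) * a) * sin (((k : ℝ) + 1) * b) / ((k : ℝ) + 1) ^ 2 =
      (C (a - b) - C (a + b)) / 2 := by
    simp only [hC]
    rw [← sum_sub_distrib, sum_div]
    refine sum_congr rfl fun k _ => ?_
    rw [mul_sub, mul_add, cos_sub, cos_add]
    ring
  have habs : C (a - b) = C |a - b| := by
    rcases abs_choice (a - b) with h | h <;> rw [h]
    simp only [hC]
    refine sum_congr rfl fun k _ => ?_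
    rw [← cos_neg, ← mul_neg]
  have hrefl : C (a + b) = C (2 * π - (a + b)) := by
    refine sum_congr rfl fun k _ => ?_
    have := cos_nat_mul_two_pi_sub (((k : ℝ) + 1) * (a + b)) (k + 1)
    rw [← this]
    push_cast
    ring_nf
  obtain ⟨ha0, ha1⟩ := ha
  obtain ⟨hb0, hb1⟩ := hb
  have hmem : |a - b| ∈ Set.Icc 0 π := ⟨abs_nonneg _, abs_le.2 ⟨by linarith, by linarith⟩⟩
  rw [heq, habs]
  rcases le_total (a + b) π with h | h
  · have := hanti hmem ⟨by linarith, h⟩ (abs_le.2 ⟨by linarith, by linarith⟩)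
    linarith
  · rw [hrefl]
    have := hanti hmem (b := 2 * π - (a + b)) ⟨by linarith, by linarith⟩
      (abs_le.2 ⟨by linarith, by linarith⟩)
    linarith

open Finset in
/-- Abel summation: an antitone nonnegative weight preserves nonnegativity of partial sums. -/
lemma sum_mul_nonneg_of_antitone {e s : ℕ → ℝ} (he : Antitone e) (he0 : ∀ n, 0 ≤ e n)
    (hs : ∀ n, 0 ≤ ∑ k ∈ range n, s k) (n : ℕ) : 0 ≤ ∑ k ∈ range n, e k * s k := by
  have key : e n * ∑ k ∈ range n, s k ≤ ∑ k ∈ range n, e k * s k := by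
    induction n with
    | zero => simp
    | succ n ih =>
      calc e (n + 1) * ∑ k ∈ range (n + 1), s k ≤ e n * ∑ k ∈ range (n + 1), s k :=
            mul_le_mul_of_nonneg_right (he n.le_succ) (hs _)
        _ = e n * ∑ k ∈ range n, s k + e n * s n := by rw [sum_range_succ, mul_add]
        _ ≤ ∑ k ∈ range (n + 1), e k * s k := by rw [sum_range_succ]; linarith
  exact (mul_nonneg (he0 n) (hs n)).trans key

/-- Reflection of the plane across the line `x = π / 2`. -/
noncomputable def reflect (z : ℝ × ℝ) : ℝ × ℝ := (π - z.1, z.2)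

lemma reflect_reflect (z : ℝ × ℝ) : reflect (reflect z) = z := by simp [reflect]

lemma measurable_reflect : Measurable reflect := by unfold reflect; fun_prop

lemma measurableEmbedding_reflect : MeasurableEmbedding reflect :=
  (MeasurableEquiv.ofInvolutive reflect reflect_reflect measurable_reflect).measurableEmbedding

lemma measurePreserving_reflect : MeasurePreserving reflect :=
  (Measure.measurePreserving_sub_left volume π).prod (MeasurePreserving.id volume)

lemma reflect_mem_iff {ℓ : ℝ} {z : ℝ × ℝ} :
    reflect z ∈ Set.Ioo (0 : ℝ) π ×ˢ Set.Ioo (-ℓ) ℓ ↔ z ∈ Set.Ioo (0 : ℝ) π ×ˢ Set.Ioo (-ℓ) ℓ := by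
  simp only [reflect, Set.mem_prod, Set.mem_Ioo, sub_pos, sub_lt_self_iff]
  tauto

/-- Two integrals over a product of reflection-invariant sets compare as soon as
the integrands compare after averaging over the reflections of both variables. -/
lemma setIntegral_le_of_sum_reflect_le {Ω : Set (ℝ × ℝ)} (hΩ : MeasurableSet Ω)
    (hinv : ∀ z, reflect z ∈ Ω ↔ z ∈ Ω) {F G : (ℝ × ℝ) × (ℝ × ℝ) → ℝ}
    (hF : IntegrableOn F (Ω ×ˢ Ω)) (hG : IntegrableOn G (Ω ×ˢ Ω))
    (hle : ∀ p ∈ Ω, ∀ q ∈ Ω,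
      F (p, q) + F (reflect p, q) + F (p, reflect q) + F (reflect p, reflect q) ≤
        G (p, q) + G (reflect p, q) + G (p, reflect q) + G (reflect p, reflect q)) :
    ∫ q in Ω ×ˢ Ω, F q ≤ ∫ q in Ω ×ˢ Ω, G q := by
  have hmp : ∀ T₁ T₂ : ℝ × ℝ → ℝ × ℝ, MeasurePreserving T₁ → MeasurePreserving T₂ →
      MeasurableEmbedding T₁ → MeasurableEmbedding T₂ →
      (∀ z, T₁ z ∈ Ω ↔ z ∈ Ω) → (∀ z, T₂ z ∈ Ω ↔ z ∈ Ω) →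
      ∀ H : (ℝ × ℝ) × (ℝ × ℝ) → ℝ, IntegrableOn H (Ω ×ˢ Ω) →
        IntegrableOn (fun q => H (T₁ q.1, T₂ q.2)) (Ω ×ˢ Ω) ∧
        ∫ q in Ω ×ˢ Ω, H (T₁ q.1, T₂ q.2) = ∫ q in Ω ×ˢ Ω, H q := by
    intro T₁ T₂ h₁ h₂ e₁ e₂ i₁ i₂ H hH
    have hP : MeasurePreserving (Prod.map T₁ T₂) := h₁.prod h₂
    have he : MeasurableEmbedding (Prod.map T₁ T₂) := e₁.prodMap e₂
    have hpre : Prod.map T₁ T₂ ⁻¹' (Ω ×ˢ Ω) = Ω ×ˢ Ω := by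
      ext q
      simp [i₁, i₂]
    have h := hP.setIntegral_preimage_emb he H (Ω ×ˢ Ω)
    have h' := (hP.integrableOn_comp_preimage he (f := H) (s := Ω ×ˢ Ω)).2 hH
    rw [hpre] at h h'
    exact ⟨h', h⟩
  have hid : MeasurePreserving (id : ℝ × ℝ → ℝ × ℝ) := MeasurePreserving.id volume
  have hide : MeasurableEmbedding (id : ℝ × ℝ → ℝ × ℝ) := MeasurableEmbedding.id
  have total : ∀ H : (ℝ × ℝ) × (ℝ × ℝ) → ℝ, IntegrableOn H (Ω ×ˢ Ω) →
      IntegrableOn (fun q => H (q.1, q.2) + H (reflect q.1, q.2) + H (q.1, reflect q.2) +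
        H (reflect q.1, reflect q.2)) (Ω ×ˢ Ω) ∧
      ∫ q in Ω ×ˢ Ω, (H (q.1, q.2) + H (reflect q.1, q.2) + H (q.1, reflect q.2) +
        H (reflect q.1, reflect q.2)) = 4 * ∫ q in Ω ×ˢ Ω, H q := by
    intro H hH
    obtain ⟨a1, b1⟩ := hmp reflect id measurePreserving_reflect hid measurableEmbedding_reflect
      hide hinv (fun _ => Iff.rfl) H hH
    obtain ⟨a2, b2⟩ := hmp id reflect hid measurePreserving_reflect hide
      measurableEmbedding_reflect (fun _ => Iff.rfl) hinv H hH
    obtain ⟨a3, b3⟩ := hmp reflect reflect measurePreserving_reflect measurePreserving_reflect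
      measurableEmbedding_reflect measurableEmbedding_reflect hinv hinv H hH
    simp only [id] at a1 b1 a2 b2
    refine ⟨((hH.add a1).add a2).add a3, ?_⟩
    have h := integral_add ((hH.add a1).add a2) a3
    rw [integral_add' (hH.add a1) a2, integral_add' hH a1, b1, b2, b3] at h
    refine h.trans ?_
    ring
  obtain ⟨hFi, hFe⟩ := total F hF
  obtain ⟨hGi, hGe⟩ := total G hG
  have := setIntegral_mono_on hFi hGi (hΩ.prod hΩ) fun q hq => hle q.1 hq.1 q.2 hq.2
  rw [hFe, hGe] at this
  linarith

/-- Four-term rearrangement inequality. -/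
lemma reflect_sum_le_of_polarized {k k' a b c d : ℝ} (h : k' ≤ k) :
    k * a * c + k' * b * c + k' * a * d + k * b * d ≤
      k * max a b * max c d + k' * min a b * max c d + k' * max a b * min c d +
        k * min a b * min c d := by
  rcases le_total a b with h₁ | h₁ <;> rcases le_total c d with h₂ | h₂ <;>
    simp only [max_eq_left, max_eq_right, min_eq_left, min_eq_right, h₁, h₂] <;>
    nlinarith [mul_nonneg (sub_nonneg.2 h) (mul_nonneg (sub_nonneg.2 h₁) (sub_nonneg.2 h₂))]

lemma polarization_of_le {v : ℝ × ℝ → ℝ} {z : ℝ × ℝ} (hz : z.1 ≤ π / 2) :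
    polarization v z = max (v z) (v (reflect z)) := if_pos hz

lemma polarization_reflect {v : ℝ × ℝ → ℝ} {z : ℝ × ℝ} (hz : z.1 ≤ π / 2) :
    polarization v (reflect z) = min (v z) (v (reflect z)) := by
  rcases hz.eq_or_lt with h | h
  · have hr : reflect z = z := Prod.ext (by simp only [reflect]; linarith) rfl
    rw [hr, polarization_of_le hz, hr, max_self, min_self]
  · have : ¬ (reflect z).1 ≤ π / 2 := by simp only [reflect]; linarith
    rw [polarization, if_neg this, min_comm]
    congr 2
    exact reflect_reflect z

lemma measurable_polarization {v : ℝ × ℝ → ℝ} (hv : Measurable v) : Measurable (polarization v) := by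
  have hr : Measurable fun z : ℝ × ℝ => v (π - z.1, z.2) := hv.comp measurable_reflect
  exact Measurable.ite (measurableSet_le measurable_fst measurable_const) (hv.max hr) (hv.min hr)

lemma measurable_weight {α β t : ℝ} {v : ℝ × ℝ → ℝ} (hv : Measurable v) :
    Measurable (weight α β t v) :=
  Measurable.ite ((measurableSet_lt measurable_const hv).inter
    (measurableSet_le hv measurable_const)) measurable_const measurable_const

/-- The product `weight * v` as a function of the value of `v`. -/
noncomputable def weighted (α β t s : ℝ) : ℝ := (if 0 < s ∧ s ≤ √t then α else β) * s

lemma weight_mul_eq (α β t : ℝ) (v : ℝ × ℝ → ℝ) (z : ℝ × ℝ) :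
    weight α β t v z * v z = weighted α β t (v z) := rfl

lemma monotoneOn_weighted {α β t : ℝ} (hα : 0 < α) (hαβ : α < β) :
    MonotoneOn (weighted α β t) (Set.Ioi 0) := by
  intro a ha b hb hab
  simp only [Set.mem_Ioi] at ha hb
  simp only [weighted, ha, hb, true_and]
  split_ifs with h₁ h₂ h₂
  · gcongr
  · nlinarith
  · exact absurd (hab.trans h₂) h₁
  · nlinarith

lemma abs_weighted_le {α β t s M : ℝ} (hα : 0 < α) (hαβ : α < β) (hs : 0 < s) (hM : s ≤ M) :
    |weighted α β t s| ≤ β * M := by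
  have hβ : 0 < β := hα.trans hαβ
  rw [weighted]
  split_ifs
  · rw [abs_of_pos (by positivity)]
    exact mul_le_mul hαβ.le hM hs.le hβ.le
  · rw [abs_of_pos (by positivity)]
    gcongr

lemma sin_succ_mul_pi_sub (m : ℕ) (x : ℝ) :
    sin (((m : ℝ) + 1) * (π - x)) = (-1) ^ m * sin (((m : ℝ) + 1) * x) := by
  have := sin_nat_mul_pi_sub (((m : ℝ) + 1) * x) (m + 1)
  rw [mul_sub]
  push_cast at this
  rw [this, pow_succ]
  ring

lemma abs_kernel_term_le {c B : ℝ} (hc : 0 ≤ c) (hB : c ≤ B) (m : ℕ) (x ρ : ℝ) :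
    ‖c / ((m : ℝ) + 1) ^ 3 * sin (((m : ℝ) + 1) * ρ) * sin (((m : ℝ) + 1) * x)‖ ≤
      B * (1 / ((m : ℝ) + 1) ^ 3) := by
  have hpos : 0 ≤ c / ((m : ℝ) + 1) ^ 3 := by positivity
  rw [norm_eq_abs, abs_mul, abs_mul, abs_of_nonneg hpos]
  calc c / ((m : ℝ) + 1) ^ 3 * |sin (((m : ℝ) + 1) * ρ)| * |sin (((m : ℝ) + 1) * x)|
      ≤ c / ((m : ℝ) + 1) ^ 3 * 1 * 1 := by
        gcongr <;> exact abs_sin_le_one _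
    _ = c * (1 / ((m : ℝ) + 1) ^ 3) := by ring
    _ ≤ B * (1 / ((m : ℝ) + 1) ^ 3) := by gcongr

lemma summable_one_div_succ_cube : Summable fun m : ℕ => 1 / ((m : ℝ) + 1) ^ 3 := by
  have h := (summable_nat_add_iff 1).2 (Real.summable_one_div_nat_pow (p := 3).2 (by norm_num))
  simpa using h

lemma summable_kernel {c : ℕ → ℝ} (hc0 : ∀ m, 0 ≤ c m) (hc : Antitone c) (x ρ : ℝ) :
    Summable fun m : ℕ =>
      c m / ((m : ℝ) + 1) ^ 3 * sin (((m : ℝ) + 1) * ρ) * sin (((m : ℝ) + 1) * x) :=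
  Summable.of_norm_bounded (summable_one_div_succ_cube.mul_left (c 0)) fun m =>
    abs_kernel_term_le (hc0 m) (hc m.zero_le) m x ρ

/-- For two points on the same side of the line `x = π / 2`, reflecting one of them
decreases the kernel. -/
lemma tsum_kernel_reflect_le {c : ℕ → ℝ} (hc0 : ∀ m, 0 ≤ c m) (hc : Antitone c) {x ρ : ℝ}
    (hx : x ∈ Set.Icc 0 (π / 2)) (hρ : ρ ∈ Set.Icc 0 (π / 2)) :
    ∑' m : ℕ, c m / ((m : ℝ) + 1) ^ 3 * sin (((m : ℝ) + 1) * ρ) * sin (((m : ℝ) + 1) * (π - x)) ≤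
      ∑' m : ℕ, c m / ((m : ℝ) + 1) ^ 3 * sin (((m : ℝ) + 1) * ρ) * sin (((m : ℝ) + 1) * x) := by
  set d : ℕ → ℝ := fun m =>
    c m / ((m : ℝ) + 1) ^ 3 * sin (((m : ℝ) + 1) * ρ) * sin (((m : ℝ) + 1) * x) -
      c m / ((m : ℝ) + 1) ^ 3 * sin (((m : ℝ) + 1) * ρ) * sin (((m : ℝ) + 1) * (π - x)) with hd_def
  have h₁ := summable_kernel hc0 hc x ρ
  have h₂ := summable_kernel hc0 hc (π - x) ρ
  have hd : Summable d := h₁.sub h₂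
  have heven : Function.Injective fun k : ℕ => 2 * k := fun i j h => by simpa using h
  have hodd : Function.Injective fun k : ℕ => 2 * k + 1 := fun i j h => by simpa using h
  have hd_even : ∀ k, d (2 * k) = 0 := by
    intro k
    simp only [hd_def]
    rw [sin_succ_mul_pi_sub, pow_mul]
    simp
  have hd_odd : ∀ k : ℕ, d (2 * k + 1) = c (2 * k + 1) / (4 * ((k : ℝ) + 1)) *
      (sin (((k : ℝ) + 1) * (2 * ρ)) * sin (((k : ℝ) + 1) * (2 * x)) / ((k : ℝ) + 1) ^ 2) := by
    intro k
    simp only [hd_def]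
    rw [sin_succ_mul_pi_sub, pow_succ (-1 : ℝ), pow_mul]
    have hk : (k : ℝ) + 1 ≠ 0 := by positivity
    have h3 : ((2 * k + 1 : ℕ) : ℝ) + 1 = 2 * ((k : ℝ) + 1) := by push_cast; ring
    rw [h3, show ((k : ℝ) + 1) * (2 * ρ) = 2 * ((k : ℝ) + 1) * ρ by ring,
      show ((k : ℝ) + 1) * (2 * x) = 2 * ((k : ℝ) + 1) * x by ring]
    norm_num
    generalize sin (2 * ((k : ℝ) + 1) * ρ) = s₁
    generalize sin (2 * ((k : ℝ) + 1) * x) = s₂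
    field_simp
    ring
  have hpartial : ∀ n, 0 ≤ ∑ k ∈ Finset.range n, d (2 * k + 1) := by
    intro n
    simp only [hd_odd]
    refine sum_mul_nonneg_of_antitone (e := fun k => c (2 * k + 1) / (4 * ((k : ℝ) + 1)))
      (fun i j hij => ?_) (fun k => div_nonneg (hc0 _) (by positivity))
      (fun k => sum_sin_mul_sin_div_sq_nonneg k ⟨by linarith [hρ.1], by linarith [hρ.2]⟩
        ⟨by linarith [hx.1], by linarith [hx.2]⟩) n
    exact div_le_div₀ (hc0 _) (hc (by omega)) (by positivity) (by gcongr)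
  rw [← sub_nonneg, ← h₁.tsum_sub h₂]
  change 0 ≤ ∑' m, d m
  rw [← tsum_even_add_odd (hd.comp_injective heven) (hd.comp_injective hodd)]
  simp only [hd_even, tsum_zero, zero_add]
  exact ge_of_tendsto' (hd.comp_injective hodd).hasSum.tendsto_sum_nat hpartial

lemma tsum_kernel_reflect_both (c : ℕ → ℝ) (x ρ : ℝ) :
    ∑' m : ℕ, c m / ((m : ℝ) + 1) ^ 3 * sin (((m : ℝ) + 1) * (π - ρ)) *
        sin (((m : ℝ) + 1) * (π - x)) =
      ∑' m : ℕ, c m / ((m : ℝ) + 1) ^ 3 * sin (((m : ℝ) + 1) * ρ) * sin (((m : ℝ) + 1) * x) := by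
  refine tsum_congr fun m => ?_
  have h : ((-1 : ℝ) ^ m) * (-1) ^ m = 1 := by rw [← mul_pow]; simp
  rw [sin_succ_mul_pi_sub, sin_succ_mul_pi_sub]
  linear_combination (c m / ((m : ℝ) + 1) ^ 3 * sin (((m : ℝ) + 1) * ρ) *
    sin (((m : ℝ) + 1) * x)) * h

/-- Pointwise comparison, after averaging over reflections, of a quadratic integrand with its
polarized version. -/
lemma sum_reflect_le_sum_reflect_polarized {Ω : Set (ℝ × ℝ)}
    (hinv : ∀ z, reflect z ∈ Ω ↔ z ∈ Ω) {k : ℝ × ℝ → ℝ × ℝ → ℝ} {f g : ℝ × ℝ → ℝ}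
    (hk : ∀ p q, k (reflect p) (reflect q) = k p q)
    (hle : ∀ p ∈ Ω, ∀ q ∈ Ω, p.1 ≤ π / 2 → q.1 ≤ π / 2 → k (reflect p) q ≤ k p q)
    (hmax : ∀ p ∈ Ω, p.1 ≤ π / 2 → g p = max (f p) (f (reflect p)))
    (hmin : ∀ p ∈ Ω, p.1 ≤ π / 2 → g (reflect p) = min (f p) (f (reflect p)))
    {p q : ℝ × ℝ} (hp : p ∈ Ω) (hq : q ∈ Ω) :
    k p q * f p * f q + k (reflect p) q * f (reflect p) * f q +
        k p (reflect q) * f p * f (reflect q) +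
        k (reflect p) (reflect q) * f (reflect p) * f (reflect q) ≤
      k p q * g p * g q + k (reflect p) q * g (reflect p) * g q +
        k p (reflect q) * g p * g (reflect q) +
        k (reflect p) (reflect q) * g (reflect p) * g (reflect q) := by
  have base : ∀ p ∈ Ω, ∀ q ∈ Ω, p.1 ≤ π / 2 → q.1 ≤ π / 2 →
      k p q * f p * f q + k (reflect p) q * f (reflect p) * f q +
          k p (reflect q) * f p * f (reflect q) +
          k (reflect p) (reflect q) * f (reflect p) * f (reflect q) ≤
        k p q * g p * g q + k (reflect p) q * g (reflect p) * g q +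
          k p (reflect q) * g p * g (reflect q) +
          k (reflect p) (reflect q) * g (reflect p) * g (reflect q) := by
    intro p hp q hq hp' hq'
    have h : k p (reflect q) = k (reflect p) q := by rw [← hk, reflect_reflect]
    rw [hmax p hp hp', hmin p hp hp', hmax q hq hq', hmin q hq hq', hk, h]
    exact reflect_sum_le_of_polarized (hle p hp q hq hp' hq')
  have hside : ∀ z : ℝ × ℝ, ¬ z.1 ≤ π / 2 → (reflect z).1 ≤ π / 2 := by
    intro z hz
    simp only [reflect]
    linarith
  by_cases hp' : p.1 ≤ π / 2 <;> by_cases hq' : q.1 ≤ π / 2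
  · exact base p hp q hq hp' hq'
  · have := base p hp (reflect q) ((hinv q).2 hq) hp' (hside q hq')
    simp only [reflect_reflect] at this
    linarith
  · have := base (reflect p) ((hinv p).2 hp) q hq (hside p hp') hq'
    simp only [reflect_reflect] at this
    linarith
  · have := base (reflect p) ((hinv p).2 hp) (reflect q) ((hinv q).2 hq) (hside p hp')
      (hside q hq')
    simp only [reflect_reflect] at this
    linarith

lemma integrableOn_mul_mul_of_bounded {Ω : Set (ℝ × ℝ)} (hΩ : MeasurableSet Ω)
    (hfin : volume Ω ≠ ⊤) {k : (ℝ × ℝ) × (ℝ × ℝ) → ℝ} {f : ℝ × ℝ → ℝ} {A B : ℝ} (hB : 0 ≤ B)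
    (hk : ContinuousOn k (Ω ×ˢ Ω)) (hkA : ∀ q ∈ Ω ×ˢ Ω, |k q| ≤ A)
    (hf : Measurable f) (hfB : ∀ z ∈ Ω, |f z| ≤ B) :
    IntegrableOn (fun q => k q * f q.1 * f q.2) (Ω ×ˢ Ω) := by
  have hvol : volume (Ω ×ˢ Ω) < ⊤ := by
    rw [Measure.volume_eq_prod, Measure.prod_prod]
    exact ENNReal.mul_lt_top hfin.lt_top hfin.lt_top
  have : IsFiniteMeasure (volume.restrict (Ω ×ˢ Ω)) := ⟨by rwa [Measure.restrict_apply_univ]⟩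
  refine Integrable.of_bound ?_ (A * B * B) ?_
  · exact ((hk.aestronglyMeasurable (hΩ.prod hΩ)).mul
      (hf.comp measurable_fst).aestronglyMeasurable).mul
      (hf.comp measurable_snd).aestronglyMeasurable
  · refine ae_restrict_of_forall_mem (hΩ.prod hΩ) fun q hq => ?_
    rw [norm_eq_abs, abs_mul, abs_mul]
    have hA : 0 ≤ A := (abs_nonneg _).trans (hkA q hq)
    have h1 := hkA q hq
    have h2 := hfB q.1 hq.1
    have h3 := hfB q.2 hq.2
    gcongr

theorem stmt19 (ℓ α β t : ℝ) (hℓ : 0 < ℓ) (hα : 0 < α) (hαβ : α < β) (ht : 0 < t)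
    (u : ℝ × ℝ → ℝ) (hmeas : Measurable u)
    (hu : ∀ z ∈ Set.Ioo (0 : ℝ) π ×ˢ Set.Ioo (-ℓ) ℓ, 0 < u z)
    (hbd : ∃ M : ℝ, ∀ z ∈ Set.Ioo (0 : ℝ) π ×ˢ Set.Ioo (-ℓ) ℓ, u z ≤ M)
    (φ : ℕ → ℝ → ℝ → ℝ)
    (hφcont : ∀ m : ℕ, 1 ≤ m →
      ContinuousOn (fun p : ℝ × ℝ => φ m p.1 p.2) (Set.Icc (-ℓ) ℓ ×ˢ Set.Icc (-ℓ) ℓ))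
    (hφ : ∀ m : ℕ, 1 ≤ m → ∀ y ∈ Set.Icc (-ℓ) ℓ, ∀ w ∈ Set.Icc (-ℓ) ℓ,
      0 < φ (m + 1) y w ∧ φ (m + 1) y w < φ m y w)
    (K : ℝ × ℝ → ℝ × ℝ → ℝ)
    (hK : ∀ p q : ℝ × ℝ, K p q =
      ∑' m : ℕ, φ (m + 1) p.2 q.2 / ((m : ℝ) + 1) ^ 3 *
        Real.sin (((m : ℝ) + 1) * q.1) * Real.sin (((m : ℝ) + 1) * p.1)) :
    ∫ q in (Set.Ioo (0 : ℝ) π ×ˢ Set.Ioo (-ℓ) ℓ) ×ˢ (Set.Ioo (0 : ℝ) π ×ˢ Set.Ioo (-ℓ) ℓ),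
        K q.1 q.2 * (weight α β t u q.1 * u q.1) * (weight α β t u q.2 * u q.2) ≤
      ∫ q in (Set.Ioo (0 : ℝ) π ×ˢ Set.Ioo (-ℓ) ℓ) ×ˢ (Set.Ioo (0 : ℝ) π ×ˢ Set.Ioo (-ℓ) ℓ),
        K q.1 q.2 * (weight α β t (polarization u) q.1 * polarization u q.1) *
          (weight α β t (polarization u) q.2 * polarization u q.2) := by
  set Ω : Set (ℝ × ℝ) := Set.Ioo (0 : ℝ) π ×ˢ Set.Ioo (-ℓ) ℓ with hΩdef
  obtain ⟨M, hM⟩ := hbd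
  have hinv : ∀ z, reflect z ∈ Ω ↔ z ∈ Ω := fun z => reflect_mem_iff
  have hΩ : MeasurableSet Ω := measurableSet_Ioo.prod measurableSet_Ioo
  have hfin : volume Ω ≠ ⊤ := by
    rw [hΩdef, Measure.volume_eq_prod, Measure.prod_prod]
    exact ENNReal.mul_ne_top (by simp) (by simp)
  have hM0 : 0 ≤ M := by
    have hmem : ((π / 2, 0) : ℝ × ℝ) ∈ Ω :=
      ⟨⟨by positivity, by linarith [pi_pos]⟩, by simpa using hℓ, hℓ⟩
    exact (hu _ hmem).le.trans (hM _ hmem)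
  have hanti : ∀ y ∈ Set.Icc (-ℓ) ℓ, ∀ w ∈ Set.Icc (-ℓ) ℓ, Antitone fun m => φ (m + 1) y w :=
    fun y hy w hw => antitone_nat_of_succ_le fun m => (hφ (m + 1) (by omega) y hy w hw).2.le
  have hpos : ∀ y ∈ Set.Icc (-ℓ) ℓ, ∀ w ∈ Set.Icc (-ℓ) ℓ, ∀ m, 0 ≤ φ (m + 1) y w := by
    intro y hy w hw m
    have h := hφ (m + 1) (by omega) y hy w hw
    exact (h.1.trans h.2).le
  have hsub : ∀ z ∈ Ω, z.2 ∈ Set.Icc (-ℓ) ℓ := fun z hz => Set.Ioo_subset_Icc_self hz.2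
  obtain ⟨C, hC⟩ := (isCompact_Icc.prod isCompact_Icc).exists_bound_of_continuousOn
    (hφcont 1 le_rfl)
  have hterm : ∀ (m : ℕ), ∀ q ∈ Ω ×ˢ Ω, ‖φ (m + 1) q.1.2 q.2.2 / ((m : ℝ) + 1) ^ 3 *
      sin (((m : ℝ) + 1) * q.2.1) * sin (((m : ℝ) + 1) * q.1.1)‖ ≤
        C * (1 / ((m : ℝ) + 1) ^ 3) := by
    intro m q hq
    have h1 := hsub _ hq.1
    have h2 := hsub _ hq.2
    refine abs_kernel_term_le (hpos _ h1 _ h2 m) ?_ m _ _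
    exact (hanti _ h1 _ h2 m.zero_le).trans ((le_abs_self _).trans (hC (_, _) ⟨h1, h2⟩))
  have hsum := summable_one_div_succ_cube.mul_left C
  have hKeq : (fun q : (ℝ × ℝ) × (ℝ × ℝ) => K q.1 q.2) = fun q =>
      ∑' m : ℕ, φ (m + 1) q.1.2 q.2.2 / ((m : ℝ) + 1) ^ 3 *
        sin (((m : ℝ) + 1) * q.2.1) * sin (((m : ℝ) + 1) * q.1.1) :=
    funext fun q => hK q.1 q.2
  have hKcont : ContinuousOn (fun q : (ℝ × ℝ) × (ℝ × ℝ) => K q.1 q.2) (Ω ×ˢ Ω) := by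
    rw [hKeq]
    refine continuousOn_tsum (fun m => ?_) hsum hterm
    have hm : ContinuousOn (fun q : (ℝ × ℝ) × (ℝ × ℝ) => φ (m + 1) q.1.2 q.2.2) (Ω ×ˢ Ω) :=
      (hφcont (m + 1) (by omega)).comp
        (f := fun q : (ℝ × ℝ) × (ℝ × ℝ) => (q.1.2, q.2.2)) (by fun_prop)
        fun q hq => ⟨hsub q.1 hq.1, hsub q.2 hq.2⟩
    exact ((hm.div_const _).mul (by fun_prop)).mul (by fun_prop)
  have hKbd : ∀ q ∈ Ω ×ˢ Ω, |K q.1 q.2| ≤ ∑' m : ℕ, C * (1 / ((m : ℝ) + 1) ^ 3) := by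
    intro q hq
    rw [hK]
    exact tsum_of_norm_bounded hsum.hasSum fun m => hterm m q hq
  have hint : ∀ v : ℝ × ℝ → ℝ, Measurable v → (∀ z ∈ Ω, 0 < v z ∧ v z ≤ M) →
      IntegrableOn (fun q : (ℝ × ℝ) × (ℝ × ℝ) => K q.1 q.2 * (weight α β t v q.1 * v q.1) *
        (weight α β t v q.2 * v q.2)) (Ω ×ˢ Ω) := fun v hv hvM =>
    integrableOn_mul_mul_of_bounded hΩ hfin (mul_nonneg (hα.trans hαβ).le hM0) hKcont hKbd
      (f := fun z => weight α β t v z * v z) ((measurable_weight hv).mul hv)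
      fun z hz => abs_weighted_le hα hαβ (hvM z hz).1 (hvM z hz).2
  have hub : ∀ z ∈ Ω, 0 < u z ∧ u z ≤ M := fun z hz => ⟨hu z hz, hM z hz⟩
  have hpol : ∀ z ∈ Ω, 0 < polarization u z ∧ polarization u z ≤ M := by
    intro z hz
    have h1 := hub z hz
    have h2 : 0 < u (π - z.1, z.2) ∧ u (π - z.1, z.2) ≤ M := hub _ ((hinv z).2 hz)
    unfold polarization
    split_ifs
    · exact ⟨lt_max_of_lt_left h1.1, max_le h1.2 h2.2⟩
    · exact ⟨lt_min h1.1 h2.1, min_le_of_left_le h1.2⟩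
  have hmono := monotoneOn_weighted (t := t) hα hαβ
  refine setIntegral_le_of_sum_reflect_le hΩ hinv (hint u hmeas hub)
    (hint _ (measurable_polarization hmeas) hpol) fun p hp q hq => ?_
  refine sum_reflect_le_sum_reflect_polarized (k := K) (f := fun z => weight α β t u z * u z)
    (g := fun z => weight α β t (polarization u) z * polarization u z) hinv
    (fun p q => ?_) (fun p hp q hq hp' hq' => ?_) (fun p hp hp' => ?_) (fun p hp hp' => ?_) hp hq
  · rw [hK, hK]
    exact tsum_kernel_reflect_both _ _ _
  · rw [hK, hK]
    exact tsum_kernel_reflect_le (hpos _ (hsub p hp) _ (hsub q hq))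
      (hanti _ (hsub p hp) _ (hsub q hq)) ⟨hp.1.1.le, hp'⟩ ⟨hq.1.1.le, hq'⟩
  · simp only [weight_mul_eq]
    rw [polarization_of_le hp']
    exact hmono.map_max (hu p hp) (hu _ ((hinv p).2 hp))
  · simp only [weight_mul_eq]
    rw [polarization_reflect hp']
    exact hmono.map_min (hu p hp) (hu _ ((hinv p).2 hp))
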